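/- The two-variable fragment of first-order logic has the weak Beth definability property: let L be a binary relational language, R a binary relation symbol not in L, L⁺ = L ∪ {R}, Th ⊆ FO2(L) a set of sentences, and Σ ⊆ FO2(L⁺) a set of sentences. If Σ is a strong implicit definition of R with respect to Th, then Σ can be made explicit with respect to Th, i.e., there is a formula φ(x,y) ∈ FO2(L) such that Th ∪ Σ ⊨ ∀x∀y (R(x,y) ↔ φ(x,y)). -/

import Mathlib

namespace AN

/-- Formulas of first-order logic over a binary relational language `L`
(a type whose elements are the binary relation symbols; there are no
function or constant symbols) with variables from `V`. -/
inductive FOV (L : Type) (V : Type) : Type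
  | eq : V → V → FOV L V
  | rel : L → V → V → FOV L V
  | not : FOV L V → FOV L V
  | and : FOV L V → FOV L V → FOV L V
  | ex : V → FOV L V → FOV L V

/-- An `L`-structure on universe `M`: an interpretation of each binary
relation symbol as a binary relation on `M`. -/
abbrev Str (L M : Type) := L → M → M → Prop

/-- Satisfaction of a formula in a structure under a valuation of the variables. -/
def Sat {L V M : Type} [DecidableEq V] (S : Str L M) : FOV L V → (V → M) → Prop
  | .eq i j, v => v i = v j
  | .rel r i j, v => S r (v i) (v j)
  | .not φ, v => ¬ Sat S φ v
  | .and φ ψ, v => Sat S φ v ∧ Sat S ψ v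
  | .ex i φ, v => ∃ m : M, Sat S φ (Function.update v i m)

/-- The free variables of a formula. -/
def Free {L V : Type} : FOV L V → Set V
  | .eq i j => {i, j}
  | .rel _ i j => {i, j}
  | .not φ => Free φ
  | .and φ ψ => Free φ ∪ Free ψ
  | .ex i φ => Free φ \ {i}

/-- A sentence is a formula with no free variables. -/
def Sentence {L V : Type} (φ : FOV L V) : Prop := Free φ = ∅

/-- The two-variable fragment FO2(L): formulas built from the two variables x, y. -/
abbrev FO2 (L : Type) := FOV L (Fin 2)

/-- The three-variable fragment FO3(L): formulas built from the three variables x, y, z. -/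
abbrev FO3 (L : Type) := FOV L (Fin 3)

/-- `M ⊨ φ[a,b]` : the FO2-formula φ holds with x interpreted as a and y as b. -/
def Sat2 {L M : Type} (S : Str L M) (φ : FO2 L) (a b : M) : Prop :=
  Sat S φ ![a, b]

/-- The 2-type of the pair (a,b) in the structure: all FO2-formulas true of (a,b). -/
def Type2 {L M : Type} (S : Str L M) (a b : M) : Set (FO2 L) :=
  {φ | Sat2 S φ a b}

/-- `f` is an automorphism of the structure `S`. -/
def IsAuto {L M : Type} (S : Str L M) (f : M ≃ M) : Prop :=
  ∀ r a b, S r a b ↔ S r (f a) (f b)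

/-- A structure is transitive if any two elements of the same type are
connected by an automorphism. -/
def IsTransitive {L M : Type} (S : Str L M) : Prop :=
  ∀ a b : M, Type2 S a a = Type2 S b b →
    ∃ f : M ≃ M, IsAuto S f ∧ f a = b

/-- A structure is 2-homogeneous if whenever a and b have the same type,
every c can be matched by some d with Type(a,c) = Type(b,d). -/
def IsHomog2 {L M : Type} (S : Str L M) : Prop :=
  ∀ a b c : M, Type2 S a a = Type2 S b b →
    ∃ d : M, Type2 S a c = Type2 S b d

/-- A 2-partial isomorphism between `S` and `T`, presented by its part `i1`
relating elements and its part `i2` relating pairs. -/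
structure IsTwoIso {L M N : Type} (S : Str L M) (T : Str L N)
    (i1 : M → N → Prop) (i2 : M → M → N → N → Prop) : Prop where
  eq_iff : ∀ a b a' b', i2 a b a' b' → (a = b ↔ a' = b')
  rel_iff2 : ∀ a b a' b', i2 a b a' b' → ∀ r,
      (S r a a ↔ T r a' a') ∧ (S r a b ↔ T r a' b') ∧
      (S r b a ↔ T r b' a') ∧ (S r b b ↔ T r b' b')
  rel_iff1 : ∀ a a', i1 a a' → ∀ r, S r a a ↔ T r a' a'
  restrict : ∀ a b a' b', i2 a b a' b' → i1 a a' ∧ i1 b b'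
  forth1 : ∀ a, ∃ a', i1 a a'
  back1 : ∀ a', ∃ a, i1 a a'
  forth2 : ∀ a a', i1 a a' → ∀ b, ∃ b', i2 a b a' b'
  back2 : ∀ a a', i1 a a' → ∀ b', ∃ b, i2 a b a' b'

/-- Two structures are 2-isomorphic when some 2-partial isomorphism between
them exists. -/
def TwoIsomorphic {L M N : Type} (S : Str L M) (T : Str L N) : Prop :=
  ∃ i1 i2, IsTwoIso S T i1 i2

/-- 2-equivalence: the same FO2 sentences hold in both structures. -/
def Equiv2 {L M N : Type} (S : Str L M) (T : Str L N) : Prop :=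
  ∀ φ : FO2 L, Sentence φ → ((∀ v, Sat S φ v) ↔ (∀ v, Sat T φ v))

/-- 3-equivalence: the same FO3 sentences hold in both structures. -/
def Equiv3 {L M N : Type} (S : Str L M) (T : Str L N) : Prop :=
  ∀ φ : FO3 L, Sentence φ → ((∀ v, Sat S φ v) ↔ (∀ v, Sat T φ v))

/-- Expansion of an `L`-structure by one new binary relation `R`; the new
relation symbol is `Sum.inr ()`, so the expanded language is `L ⊕ Unit`. -/
def expand {L M : Type} (S : Str L M) (R : M → M → Prop) : Str (L ⊕ Unit) M :=
  Sum.elim S (fun _ => R)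

/-- `S` is a model of the set `Th` of sentences. -/
def ModelsSet {L V M : Type} [DecidableEq V] (S : Str L M) (Th : Set (FOV L V)) : Prop :=
  ∀ φ ∈ Th, ∀ v : V → M, Sat S φ v

/-- `Sg` is a weak implicit definition of the new relation symbol w.r.t. `Th`:
in each model of `Th` there is at most one relation satisfying `Sg`. -/
def WeakImplicitDef (L : Type) (Th : Set (FO2 L)) (Sg : Set (FO2 (L ⊕ Unit))) : Prop :=
  ∀ (M : Type) (S : Str L M), Nonempty M → ModelsSet S Th →
    ∀ R R' : M → M → Prop,
      ModelsSet (expand S R) Sg → ModelsSet (expand S R') Sg → R = R'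

/-- `Sg` is a strong implicit definition of the new relation symbol w.r.t. `Th`:
in each model of `Th` there is exactly one relation satisfying `Sg`. -/
def StrongImplicitDef (L : Type) (Th : Set (FO2 L)) (Sg : Set (FO2 (L ⊕ Unit))) : Prop :=
  ∀ (M : Type) (S : Str L M), Nonempty M → ModelsSet S Th →
    ∃! R : M → M → Prop, ModelsSet (expand S R) Sg

/-- `Sg` can be made explicit w.r.t. `Th`: there is an FO2(L)-formula φ(x,y)
with Th ∪ Sg ⊨ ∀x∀y (R(x,y) ↔ φ(x,y)). -/
def MadeExplicit (L : Type) (Th : Set (FO2 L)) (Sg : Set (FO2 (L ⊕ Unit))) : Prop :=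
  ∃ φ : FO2 L, ∀ (M : Type) (S : Str L M), Nonempty M → ModelsSet S Th →
    ∀ R : M → M → Prop, ModelsSet (expand S R) Sg →
      ∀ a b : M, R a b ↔ Sat2 S φ a b

/-- `R` does not cut 2-types in `S`. -/
def NoCut {L M : Type} (S : Str L M) (R : M → M → Prop) : Prop :=
  ∀ a b c d : M, Type2 S a b = Type2 S c d → (R a b ↔ R c d)

/-- The valuation sending the variable `0` (i.e. x) to `m` and the variables
`1,…,k` (the constants naming the tuple `t`) to the entries of `t`. -/
def valCons {M : Type} (m : M) {k : ℕ} (t : Fin k → M) : ℕ → M :=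
  fun i => if h : 0 < i ∧ i - 1 < k then t ⟨i - 1, h.2⟩ else m

/-- ω-saturation, phrased with formulas whose free variables are among
x = variable 0 and the constants = variables 1,…,k naming a finite tuple t:
if every finite subset of Γ(x) is satisfiable in (M,t), then Γ(x) is realized. -/
def OmegaSaturated {L M : Type} (S : Str L M) : Prop :=
  ∀ (k : ℕ) (t : Fin k → M) (Γ : Set (FOV L ℕ)),
    (∀ φ ∈ Γ, Free φ ⊆ {i | i ≤ k}) →
    (∀ Γ₀ : Finset (FOV L ℕ), ↑Γ₀ ⊆ Γ →
        ∃ m : M, ∀ φ ∈ Γ₀, Sat S φ (valCons m t)) →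
    ∃ m : M, ∀ φ ∈ Γ, Sat S φ (valCons m t)

/-- The new relation symbol cannot cut the formula π:
Th ∪ Sg ⊨ ∀x∀y(π → R(x,y)) or Th ∪ Sg ⊨ ∀x∀y(π → ¬R(x,y)). -/
def CannotCut (L : Type) (Th : Set (FO2 L)) (Sg : Set (FO2 (L ⊕ Unit))) (π : FO2 L) : Prop :=
  (∀ (M : Type) (S : Str L M), Nonempty M → ModelsSet S Th →
      ∀ R : M → M → Prop, ModelsSet (expand S R) Sg →
        ∀ a b : M, Sat2 S π a b → R a b) ∨
  (∀ (M : Type) (S : Str L M), Nonempty M → ModelsSet S Th →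
      ∀ R : M → M → Prop, ModelsSet (expand S R) Sg →
        ∀ a b : M, Sat2 S π a b → ¬ R a b)

/-- `π` is a 2-partition with respect to Th ∪ Sg: Th ∪ Sg ⊨ ∀x∀y ⋁ᵢ πᵢ and
Th ∪ Sg ⊨ ∀x∀y ¬(πᵢ ∧ πⱼ) for i < j. -/
def IsTwoPartition (L : Type) (Th : Set (FO2 L)) (Sg : Set (FO2 (L ⊕ Unit)))
    {n : ℕ} (π : Fin (n + 1) → FO2 L) : Prop :=
  ∀ (M : Type) (S : Str L M), Nonempty M → ModelsSet S Th →
    ∀ R : M → M → Prop, ModelsSet (expand S R) Sg →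
      (∀ a b : M, ∃ i, Sat2 S (π i) a b) ∧
      (∀ a b : M, ∀ i j : Fin (n + 1), i < j →
        ¬(Sat2 S (π i) a b ∧ Sat2 S (π j) a b))

/-- The binary relation defined in `S` by an FO3-formula ρ(x,y) with free
variables among x = 0 and y = 1 (the value of z is immaterial). -/
def rel3 {L M : Type} (S : Str L M) (ρ : FO3 L) : Set (M × M) :=
  {p | Sat S ρ ![p.1, p.2, p.2]}

/-- The FO3-definable binary relations of `S`. -/
def Def3 {L M : Type} (S : Str L M) : Set (Set (M × M)) :=
  {Z | ∃ ρ : FO3 L, Free ρ ⊆ ({0, 1} : Set (Fin 3)) ∧ Z = rel3 S ρ}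

/-- Converse of a binary relation. -/
def conv {M : Type} (Z : Set (M × M)) : Set (M × M) := {p | (p.2, p.1) ∈ Z}

/-- Composition of binary relations. -/
def comp {M : Type} (Z W : Set (M × M)) : Set (M × M) :=
  {p | ∃ v, (p.1, v) ∈ Z ∧ (v, p.2) ∈ W}

/-! ### Homogeneous colourings -/

section Coloring

variable {T : Type}

/-- Axioms for a system of 2-types: `d` singles out the diagonal (one-element) types, `l` and `r`
restrict a 2-type to its first and second coordinate, and `cv` interchanges the coordinates.
A diagonal type over which there is no other type is the right end of at most one type with a
given left end. -/
structure IsTypeSystem (d : T → Prop) (l r cv : T → T) : Prop where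
  d_l : ∀ c, d (l c)
  l_of_d : ∀ c, d c → l c = c
  r_of_d : ∀ c, d c → r c = c
  cv_of_d : ∀ c, d c → cv c = c
  cv_cv : ∀ c, cv (cv c) = c
  l_cv : ∀ c, l (cv c) = r c
  amalg : ∀ p q, d p → d q → ∃ c, l c = p ∧ r c = q
  split : ∀ c c', l c = l c' → r c = r c' → c ≠ c' → ∃ e, ¬ d e ∧ l e = r c ∧ r e = r c

namespace IsTypeSystem

variable {d : T → Prop} {l r cv : T → T}

lemma r_cv (H : IsTypeSystem d l r cv) (c : T) : r (cv c) = l c := by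
  rw [← H.l_cv, H.cv_cv]

lemma d_of_d_cv (H : IsTypeSystem d l r cv) {c : T} (h : d (cv c)) : d c := by
  have := H.cv_of_d _ h
  rw [H.cv_cv] at this
  rwa [this]

open Classical in
/-- There is a choice of nondiagonal types, depending on the two ends and on an element of a group,
that is compatible with converses and exhausts all nondiagonal types. -/
lemma exists_choice (H : IsTypeSystem d l r cv) :
    ∃ F : T → T → (T → ℤ) → T,
      (∀ p q k, (∃ c, l c = p ∧ r c = q ∧ ¬ d c) →
        l (F p q k) = p ∧ r (F p q k) = q ∧ ¬ d (F p q k)) ∧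
      (∀ p q k, (p ≠ q ∨ k ≠ 0) → F q p (-k) = cv (F p q k)) ∧
      (∀ c, ¬ d c → F (l c) (r c) (Pi.single c 1) = c) := by
  rcases isEmpty_or_nonempty T with hT | hT
  · exact ⟨fun p => hT.elim p, fun p => hT.elim p, fun p => hT.elim p, fun p => hT.elim p⟩
  let N : T → T → T → Prop := fun p q c => l c = p ∧ r c = q ∧ ¬ d c
  let e : T → T → T := fun p q => Classical.epsilon (N p q)
  let lt : (T × T × (T → ℤ)) → (T × T × (T → ℤ)) → Prop := WellOrderingRel
  have inj : ∀ c c' : T, (Pi.single c 1 : T → ℤ) = Pi.single c' 1 → c = c' := by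
    intro c c' h
    by_contra hne
    have := congrFun h c
    simp [hne] at this
  have noneg : ∀ c c' : T, (Pi.single c 1 : T → ℤ) ≠ -Pi.single c' 1 := by
    intro c c' h
    have := congrFun h c
    simp only [Pi.single_apply, Pi.neg_apply] at this
    split_ifs at this <;> simp_all
  have Ncv : ∀ p q c, N p q c → N q p (cv c) := fun p q c h =>
    ⟨(H.l_cv c).trans h.2.1, (H.r_cv c).trans h.1, fun h' => h.2.2 (H.d_of_d_cv h')⟩
  let F : T → T → (T → ℤ) → T := fun p q k =>
    if h : ∃ c, N p q c ∧ k = Pi.single c 1 then h.choose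
    else if h : ∃ c, N q p c ∧ -k = Pi.single c 1 then cv h.choose
    else if lt (p, q, k) (q, p, -k) then e p q else cv (e q p)
  have F1 : ∀ p q c, N p q c → F p q (Pi.single c 1) = c := by
    intro p q c hc
    have h : ∃ c', N p q c' ∧ (Pi.single c 1 : T → ℤ) = Pi.single c' 1 := ⟨c, hc, rfl⟩
    simp only [F, dif_pos h]
    exact (inj _ _ h.choose_spec.2).symm
  have F2 : ∀ p q c, N q p c → F p q (-Pi.single c 1) = cv c := by
    intro p q c hc
    have h0 : ¬ ∃ c', N p q c' ∧ (-Pi.single c 1 : T → ℤ) = Pi.single c' 1 := by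
      rintro ⟨c', -, h⟩
      exact noneg _ _ h.symm
    have h : ∃ c', N q p c' ∧ -(-Pi.single c 1 : T → ℤ) = Pi.single c' 1 :=
      ⟨c, hc, neg_neg _⟩
    simp only [F, dif_neg h0, dif_pos h]
    rw [← inj _ _ ((neg_neg _).symm.trans h.choose_spec.2)]
  refine ⟨F, ?_, ?_, fun c hc => F1 _ _ _ ⟨rfl, rfl, hc⟩⟩
  · intro p q k hex
    change N p q (F p q k)
    by_cases h1 : ∃ c, N p q c ∧ k = Pi.single c 1
    · obtain ⟨c, hc, rfl⟩ := h1
      rwa [F1 _ _ _ hc]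
    by_cases h2 : ∃ c, N q p c ∧ -k = Pi.single c 1
    · obtain ⟨c, hc, h⟩ := h2
      obtain rfl : k = -Pi.single c 1 := by rw [← h, neg_neg]
      rw [F2 _ _ _ hc]
      exact Ncv _ _ _ hc
    simp only [F, dif_neg h1, dif_neg h2]
    split_ifs
    · exact Classical.epsilon_spec (p := N p q) hex
    · obtain ⟨c, hc⟩ := hex
      exact Ncv _ _ _ (Classical.epsilon_spec (p := N q p) ⟨cv c, Ncv _ _ _ hc⟩)
  · intro p q k hk
    by_cases h1 : ∃ c, N p q c ∧ k = Pi.single c 1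
    · obtain ⟨c, hc, rfl⟩ := h1
      rw [F1 _ _ _ hc, F2 _ _ _ hc]
    by_cases h2 : ∃ c, N q p c ∧ -k = Pi.single c 1
    · obtain ⟨c, hc, h⟩ := h2
      obtain rfl : k = -Pi.single c 1 := by rw [← h, neg_neg]
      rw [neg_neg, F1 _ _ _ hc, F2 _ _ _ hc, H.cv_cv]
    have hne : ((p, q, k) : T × T × (T → ℤ)) ≠ (q, p, -k) := by
      intro h
      simp only [Prod.mk.injEq] at h
      rcases hk with hk | hk
      · exact hk h.1
      · exact hk (self_eq_neg.mp h.2.2)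
    simp only [F, dif_neg h1, dif_neg h2, neg_neg]
    rcases trichotomous_of (WellOrderingRel (α := T × T × (T → ℤ))) (p, q, k) (q, p, -k)
      with h | h | h
    · have h' : ¬ lt (q, p, -k) (p, q, k) := asymm_of WellOrderingRel h
      rw [if_neg h', if_pos (show lt _ _ from h)]
    · exact absurd h hne
    · have h' : ¬ lt (p, q, k) (q, p, -k) := asymm_of WellOrderingRel h
      rw [if_neg h', if_pos (show lt _ _ from h), H.cv_cv]

/-- Every type system is realised by a colouring of the pairs of some set in which all types
extending the type of a point occur at that point, and in which any two points of the same type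
are connected by an automorphism. -/
theorem exists_coloring (H : IsTypeSystem d l r cv) :
    ∃ (U : Type) (col : U → U → T),
      (∀ a b, d (col a b) ↔ a = b) ∧
      (∀ a b, l (col a b) = col a a) ∧
      (∀ a b, col b a = cv (col a b)) ∧
      (∀ p, d p → ∃ a, col a a = p) ∧
      (∀ a c, l c = col a a → ∃ b, col a b = c) ∧
      (∀ a a', col a a = col a' a' →
        ∃ f : U ≃ U, f a = a' ∧ ∀ x y, col (f x) (f y) = col x y) := by
  classical
  obtain ⟨F, hF, hFcv, hFsurj⟩ := H.exists_choice
  let king : T → Prop := fun p => ∀ c, l c = p → r c = p → d c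
  let U : Type := {u : T × (T → ℤ) // d u.1 ∧ (king u.1 → u.2 = 0)}
  let col : U → U → T := fun u v => if u = v then u.1.1 else F u.1.1 v.1.1 (v.1.2 - u.1.2)
  have col_self : ∀ u : U, col u u = u.1.1 := fun u => if_pos rfl
  have col_ne : ∀ u v : U, u ≠ v → col u v = F u.1.1 v.1.1 (v.1.2 - u.1.2) :=
    fun u v h => if_neg h
  have uniq : ∀ c c', l c = l c' → r c = r c' → king (r c) → c = c' := by
    intro c c' h1 h2 hk
    by_contra hne
    obtain ⟨e, he, h3, h4⟩ := H.split c c' h1 h2 hne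
    exact he (hk e h3 h4)
  have uniq' : ∀ c c', l c = l c' → r c = r c' → king (l c) → c = c' := by
    intro c c' h1 h2 hk
    have := uniq (cv c) (cv c') (by rw [H.l_cv, H.l_cv, h2]) (by rw [H.r_cv, H.r_cv, h1])
      (by rwa [H.r_cv])
    rw [← H.cv_cv c, this, H.cv_cv]
  have not_king : ∀ u v : U, u ≠ v → u.1.1 = v.1.1 → ¬ king u.1.1 := by
    intro u v h huv hk
    refine h (Subtype.ext (Prod.ext huv ?_))
    rw [u.2.2 hk, v.2.2 (huv ▸ hk)]
  have spec : ∀ u v : U, u ≠ v →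
      l (col u v) = u.1.1 ∧ r (col u v) = v.1.1 ∧ ¬ d (col u v) := by
    intro u v h
    rw [col_ne u v h]
    apply hF
    by_cases huv : u.1.1 = v.1.1
    · have := not_king u v h huv
      simp only [king, not_forall] at this
      obtain ⟨c, h1, h2, h3⟩ := this
      exact ⟨c, h1, h2.trans huv, h3⟩
    · obtain ⟨c, h1, h2⟩ := H.amalg _ _ u.2.1 v.2.1
      refine ⟨c, h1, h2, fun h3 => huv ?_⟩
      rw [← h1, ← h2, H.l_of_d _ h3, H.r_of_d _ h3]
  refine ⟨U, col, ?_, ?_, ?_, ?_, ?_, ?_⟩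
  · intro a b
    refine ⟨fun h => by_contra fun hne => (spec a b hne).2.2 h, ?_⟩
    rintro rfl
    rw [col_self]
    exact a.2.1
  · intro a b
    by_cases h : a = b
    · subst h
      rw [col_self, H.l_of_d _ a.2.1]
    · rw [(spec a b h).1, col_self]
  · intro a b
    by_cases h : a = b
    · subst h
      rw [col_self, H.cv_of_d _ a.2.1]
    · rw [col_ne _ _ h, col_ne _ _ (Ne.symm h), ← hFcv, neg_sub]
      by_contra! hc
      exact h (Subtype.ext (Prod.ext hc.1 (sub_eq_zero.mp hc.2).symm))
  · intro p hp
    exact ⟨⟨(p, 0), hp, fun _ => rfl⟩, col_self _⟩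
  · intro a c hc
    rw [col_self] at hc
    by_cases hd : d c
    · exact ⟨a, by rw [col_self, ← hc, H.l_of_d _ hd]⟩
    have hr : d (r c) := by
      rw [← H.l_cv]
      exact H.d_l _
    by_cases hk : king (r c)
    · let b : U := ⟨(r c, 0), hr, fun _ => rfl⟩
      have hab : a ≠ b := by
        intro h
        have : a.1.1 = r c := congrArg (fun u : U => u.1.1) h
        exact hd (hk c (hc.trans this) rfl)
      obtain ⟨h1, h2, -⟩ := spec a b hab
      refine ⟨b, (uniq _ _ ?_ ?_ hk).symm⟩
      · rw [hc, h1]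
      · rw [h2]
    · let b : U := ⟨(r c, a.1.2 + Pi.single c 1), hr, fun h => absurd h hk⟩
      have hab : a ≠ b := by
        intro h
        have : a.1.2 = a.1.2 + Pi.single c 1 := congrArg (fun u : U => u.1.2) h
        simp at this
      refine ⟨b, ?_⟩
      rw [col_ne _ _ hab, ← hc]
      simp only [b, add_sub_cancel_left]
      exact hFsurj c hd
  · intro a a' haa
    rw [col_self, col_self] at haa
    let sh : (T → ℤ) → U → U := fun h u =>
      ⟨(u.1.1, if king u.1.1 then 0 else u.1.2 + h), u.2.1, fun hk => if_pos hk⟩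
    have sh_sh : ∀ h u, sh (-h) (sh h u) = u := by
      intro h u
      apply Subtype.ext
      by_cases hk : king u.1.1
      · exact Prod.ext rfl (by simp [sh, hk, u.2.2 hk])
      · exact Prod.ext rfl (by simp [sh, hk])
    let f : U ≃ U := ⟨sh (a'.1.2 - a.1.2), sh (-(a'.1.2 - a.1.2)), sh_sh _, fun u => by
      simpa using sh_sh (-(a'.1.2 - a.1.2)) u⟩
    refine ⟨f, ?_, ?_⟩
    · apply Subtype.ext
      refine Prod.ext haa ?_
      by_cases hk : king a.1.1
      · have hk' : king a'.1.1 := haa ▸ hk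
        simp [f, sh, hk, a'.2.2 hk']
      · simp [f, sh, hk]
    · intro x y
      by_cases hxy : x = y
      · subst hxy
        rw [col_self, col_self]
        rfl
      have hxy' : f x ≠ f y := fun h => hxy (f.injective h)
      obtain ⟨h1, h2, -⟩ := spec x y hxy
      obtain ⟨h1', h2', -⟩ := spec _ _ hxy'
      have e1 : (f x).1.1 = x.1.1 := rfl
      have e2 : (f y).1.1 = y.1.1 := rfl
      by_cases hkx : king x.1.1
      · exact uniq' _ _ (by rw [h1, h1', e1]) (by rw [h2, h2', e2]) (by rwa [h1', e1])
      by_cases hky : king y.1.1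
      · exact uniq _ _ (by rw [h1, h1', e1]) (by rw [h2, h2', e2]) (by rwa [h2', e2])
      rw [col_ne _ _ hxy, col_ne _ _ hxy', e1, e2]
      simp [f, sh, hkx, hky]

end IsTypeSystem

end Coloring

/-! ### Semantics of two-variable formulas -/

section Semantics

variable {K K' M N : Type}

lemma update_pair_zero (a b c : M) : Function.update ![a, b] (0 : Fin 2) c = ![c, b] := by
  ext i
  fin_cases i <;> simp

lemma update_pair_one (a b c : M) : Function.update ![a, b] (1 : Fin 2) c = ![a, c] := by
  ext i
  fin_cases i <;> simp

lemma sat2_ex_zero (S : Str K M) (φ : FO2 K) (a b : M) :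
    Sat2 S (.ex 0 φ) a b ↔ ∃ c, Sat2 S φ c b := by
  simp [Sat2, Sat, update_pair_zero]

lemma sat2_ex_one (S : Str K M) (φ : FO2 K) (a b : M) :
    Sat2 S (.ex 1 φ) a b ↔ ∃ c, Sat2 S φ a c := by
  simp [Sat2, Sat, update_pair_one]

lemma sat2_not (S : Str K M) (φ : FO2 K) (a b : M) :
    Sat2 S (.not φ) a b ↔ ¬ Sat2 S φ a b := Iff.rfl

lemma sat2_and (S : Str K M) (φ ψ : FO2 K) (a b : M) :
    Sat2 S (.and φ ψ) a b ↔ Sat2 S φ a b ∧ Sat2 S ψ a b := Iff.rfl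

lemma sat2_eq (S : Str K M) (a b : M) : Sat2 S (.eq 0 1) a b ↔ a = b := Iff.rfl

lemma modelsSet_iff_sat2 (S : Str K M) (Th : Set (FO2 K)) :
    ModelsSet S Th ↔ ∀ φ ∈ Th, ∀ a b, Sat2 S φ a b := by
  refine forall₂_congr fun φ _ => ⟨fun h a b => h _, fun h v => ?_⟩
  have : v = ![v 0, v 1] := by
    ext i
    fin_cases i <;> rfl
  rw [this]
  exact h _ _

/-- Renaming of relation symbols together with a permutation of the variables. -/
def rename {V : Type} (f : K → K') (σ : V ≃ V) : FOV K V → FOV K' V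
  | .eq i j => .eq (σ i) (σ j)
  | .rel s i j => .rel (f s) (σ i) (σ j)
  | .not φ => .not (rename f σ φ)
  | .and φ ψ => .and (rename f σ φ) (rename f σ ψ)
  | .ex i φ => .ex (σ i) (rename f σ φ)

lemma sat_rename {V : Type} [DecidableEq V] (f : K → K') (σ : V ≃ V) (S : Str K' M)
    (φ : FOV K V) (v : V → M) :
    Sat S (rename f σ φ) v ↔ Sat (fun s => S (f s)) φ (v ∘ σ) := by
  induction φ generalizing v with
  | eq i j => exact Iff.rfl
  | rel s i j => exact Iff.rfl
  | not φ ih => exact not_congr (ih v)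
  | and φ ψ ih ih' => exact and_congr (ih v) (ih' v)
  | ex i φ ih =>
    refine exists_congr fun m => ?_
    rw [ih, Function.update_comp_equiv, Equiv.symm_apply_apply]

/-- Interchange of the two variables. -/
def flip : FO2 K → FO2 K := rename id (Equiv.swap 0 1)

lemma sat2_flip (S : Str K M) (φ : FO2 K) (a b : M) : Sat2 S (flip φ) a b ↔ Sat2 S φ b a := by
  have : (![a, b] ∘ Equiv.swap (0 : Fin 2) 1) = ![b, a] := by
    ext i
    fin_cases i <;> simp
  unfold Sat2 flip
  rw [sat_rename, this]
  rfl

/-- A formula of the language `L` seen as a formula of the expanded language. -/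
def lift {L : Type} : FO2 L → FO2 (L ⊕ Unit) := rename Sum.inl (Equiv.refl _)

lemma sat2_lift {L : Type} (S : Str (L ⊕ Unit) M) (φ : FO2 L) (a b : M) :
    Sat2 S (lift φ) a b ↔ Sat2 (fun s => S (.inl s)) φ a b := by
  unfold Sat2 lift
  rw [sat_rename]
  rfl

/-- `φ(x,x)`, as a formula in which `y` is not free. -/
def diagL (φ : FO2 K) : FO2 K := .ex 1 (.and (.eq 0 1) φ)

lemma sat2_diagL (S : Str K M) (φ : FO2 K) (a b : M) :
    Sat2 S (diagL φ) a b ↔ Sat2 S φ a a := by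
  simp [diagL, sat2_ex_one, sat2_and, sat2_eq]

/-- `φ(y,y)`, as a formula in which `x` is not free. -/
def diagR (φ : FO2 K) : FO2 K := .ex 0 (.and (.eq 0 1) φ)

lemma sat2_diagR (S : Str K M) (φ : FO2 K) (a b : M) :
    Sat2 S (diagR φ) a b ↔ Sat2 S φ b b := by
  simp [diagR, sat2_ex_zero, sat2_and, sat2_eq]

/-- The sentence `∃x∃y φ`. -/
def exAll (φ : FO2 K) : FO2 K := .ex 0 (.ex 1 φ)

lemma sat2_exAll (S : Str K M) (φ : FO2 K) (a b : M) :
    Sat2 S (exAll φ) a b ↔ ∃ c e, Sat2 S φ c e := by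
  simp [exAll, sat2_ex_zero, sat2_ex_one]

/-- A two-pebble back-and-forth system preserves two-variable formulas. -/
lemma sat2_congr_of_backForth {S : Str K M} {S' : Str K N} {Z : M → M → N → N → Prop}
    (eq_iff : ∀ a b a' b', Z a b a' b' → (a = b ↔ a' = b'))
    (rel_iff : ∀ a b a' b', Z a b a' b' → ∀ s, S s a b ↔ S' s a' b')
    (diag : ∀ a b a' b', Z a b a' b' → Z a a a' a')
    (symm : ∀ a b a' b', Z a b a' b' → Z b a b' a')
    (forth : ∀ a b a' b', Z a b a' b' → ∀ c, ∃ c', Z a c a' c')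
    (back : ∀ a b a' b', Z a b a' b' → ∀ c', ∃ c, Z a c a' c')
    (φ : FO2 K) {a b : M} {a' b' : N} (h : Z a b a' b') : Sat2 S φ a b ↔ Sat2 S' φ a' b' := by
  induction φ generalizing a b a' b' with
  | eq i j =>
    fin_cases i <;> fin_cases j
    · simp [Sat2, Sat]
    · exact eq_iff _ _ _ _ h
    · exact eq_iff _ _ _ _ (symm _ _ _ _ h)
    · simp [Sat2, Sat]
  | rel s i j =>
    fin_cases i <;> fin_cases j
    · exact rel_iff _ _ _ _ (diag _ _ _ _ h) s
    · exact rel_iff _ _ _ _ h s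
    · exact rel_iff _ _ _ _ (symm _ _ _ _ h) s
    · exact rel_iff _ _ _ _ (diag _ _ _ _ (symm _ _ _ _ h)) s
  | not φ ih => exact not_congr (ih h)
  | and φ ψ ih ih' => exact and_congr (ih h) (ih' h)
  | ex i φ ih =>
    fin_cases i
    · simp only [Fin.zero_eta, sat2_ex_zero]
      constructor
      · rintro ⟨c, hc⟩
        obtain ⟨c', hc'⟩ := forth _ _ _ _ (symm _ _ _ _ h) c
        exact ⟨c', (ih (symm _ _ _ _ hc')).1 hc⟩
      · rintro ⟨c', hc'⟩
        obtain ⟨c, hc⟩ := back _ _ _ _ (symm _ _ _ _ h) c'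
        exact ⟨c, (ih (symm _ _ _ _ hc)).2 hc'⟩
    · simp only [Fin.mk_one, sat2_ex_one]
      constructor
      · rintro ⟨c, hc⟩
        obtain ⟨c', hc'⟩ := forth _ _ _ _ h c
        exact ⟨c', (ih hc').1 hc⟩
      · rintro ⟨c', hc'⟩
        obtain ⟨c, hc⟩ := back _ _ _ _ h c'
        exact ⟨c, (ih hc).2 hc'⟩

end Semantics

/-! ### The space of 2-types -/

section Types

variable {K K' : Type}

/-- A structure with two distinguished elements. -/
structure Pointed (K : Type) : Type 1 where
  /-- the universe -/
  carrier : Type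
  /-- the interpretation of the relation symbols -/
  str : Str K carrier
  /-- the first distinguished element -/
  fst : carrier
  /-- the second distinguished element -/
  snd : carrier

namespace Pointed

/-- Truth of a formula at the distinguished pair. -/
def Holds (m : Pointed K) (φ : FO2 K) : Prop := Sat2 m.str φ m.fst m.snd

/-- Replace the distinguished pair `(a,b)` by `(a,a)`. -/
def left (m : Pointed K) : Pointed K := ⟨m.carrier, m.str, m.fst, m.fst⟩

/-- Replace the distinguished pair `(a,b)` by `(b,b)`. -/
def right (m : Pointed K) : Pointed K := ⟨m.carrier, m.str, m.snd, m.snd⟩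

/-- Forget the new relation. -/
def reduct {L : Type} (m : Pointed (L ⊕ Unit)) : Pointed L :=
  ⟨m.carrier, fun s => m.str (.inl s), m.fst, m.snd⟩

end Pointed

/-- The set of formulas true at `𝒰`-almost all pointed structures. -/
def typeOf (𝒰 : Ultrafilter (Pointed K)) : Set (FO2 K) :=
  {φ | ∀ᶠ m in (𝒰 : Filter (Pointed K)), m.Holds φ}

/-- `p` is a complete 2-type of the language `K`. -/
def IsType (p : Set (FO2 K)) : Prop := ∃ 𝒰 : Ultrafilter (Pointed K), p = typeOf 𝒰

/-- The type of `(a,a)` when `p` is the type of `(a,b)`. -/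
def leftType (p : Set (FO2 K)) : Set (FO2 K) := {φ | diagL φ ∈ p}

/-- The type of `(b,b)` when `p` is the type of `(a,b)`. -/
def rightType (p : Set (FO2 K)) : Set (FO2 K) := {φ | diagR φ ∈ p}

/-- The type of `(b,a)` when `p` is the type of `(a,b)`. -/
def convType (p : Set (FO2 K)) : Set (FO2 K) := {φ | flip φ ∈ p}

/-- The restriction of a type of the expanded language to the original language. -/
def reductType {L : Type} (p : Set (FO2 (L ⊕ Unit))) : Set (FO2 L) := {φ | lift φ ∈ p}

lemma typeOf_map_left (𝒰 : Ultrafilter (Pointed K)) :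
    typeOf (𝒰.map Pointed.left) = leftType (typeOf 𝒰) := by
  ext φ
  exact Filter.eventually_congr
    (.of_forall fun m : Pointed K => (sat2_diagL m.str φ m.fst m.snd).symm)

lemma typeOf_map_right (𝒰 : Ultrafilter (Pointed K)) :
    typeOf (𝒰.map Pointed.right) = rightType (typeOf 𝒰) := by
  ext φ
  exact Filter.eventually_congr
    (.of_forall fun m : Pointed K => (sat2_diagR m.str φ m.fst m.snd).symm)

lemma typeOf_map_reduct {L : Type} (𝒰 : Ultrafilter (Pointed (L ⊕ Unit))) :
    typeOf (𝒰.map Pointed.reduct) = reductType (typeOf 𝒰) := by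
  ext φ
  exact Filter.eventually_congr
    (.of_forall fun m : Pointed (L ⊕ Unit) => (sat2_lift m.str φ m.fst m.snd).symm)

lemma isType_type2 {M : Type} (S : Str K M) (a b : M) : IsType (Type2 S a b) := by
  refine ⟨pure ⟨M, S, a, b⟩, ?_⟩
  ext φ
  rfl

lemma leftType_type2 {M : Type} (S : Str K M) (a b : M) :
    leftType (Type2 S a b) = Type2 S a a := by
  ext φ
  exact sat2_diagL S φ a b

lemma rightType_type2 {M : Type} (S : Str K M) (a b : M) :
    rightType (Type2 S a b) = Type2 S b b := by
  ext φ
  exact sat2_diagR S φ a b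

lemma convType_type2 {M : Type} (S : Str K M) (a b : M) :
    convType (Type2 S a b) = Type2 S b a := by
  ext φ
  exact sat2_flip S φ a b

lemma reductType_type2 {L M : Type} (S : Str (L ⊕ Unit) M) (a b : M) :
    reductType (Type2 S a b) = Type2 (fun s => S (.inl s)) a b := by
  ext φ
  exact sat2_lift S φ a b

namespace IsType

variable {p q : Set (FO2 K)}

lemma left (hp : IsType p) : IsType (leftType p) := by
  obtain ⟨𝒰, rfl⟩ := hp
  exact ⟨_, (typeOf_map_left 𝒰).symm⟩

lemma right (hp : IsType p) : IsType (rightType p) := by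
  obtain ⟨𝒰, rfl⟩ := hp
  exact ⟨_, (typeOf_map_right 𝒰).symm⟩

lemma conv (hp : IsType p) : IsType (convType p) := by
  obtain ⟨𝒰, rfl⟩ := hp
  refine ⟨𝒰.map fun m => ⟨m.carrier, m.str, m.snd, m.fst⟩, ?_⟩
  ext φ
  exact Filter.eventually_congr
    (.of_forall fun m : Pointed K => sat2_flip m.str φ m.fst m.snd)

lemma reduct {L : Type} {p : Set (FO2 (L ⊕ Unit))} (hp : IsType p) : IsType (reductType p) := by
  obtain ⟨𝒰, rfl⟩ := hp
  exact ⟨_, (typeOf_map_reduct 𝒰).symm⟩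

lemma and_mem_iff (hp : IsType p) {φ ψ : FO2 K} : FOV.and φ ψ ∈ p ↔ φ ∈ p ∧ ψ ∈ p := by
  obtain ⟨𝒰, rfl⟩ := hp
  exact Filter.eventually_and

lemma not_mem_iff (hp : IsType p) {φ : FO2 K} : FOV.not φ ∈ p ↔ φ ∉ p := by
  obtain ⟨𝒰, rfl⟩ := hp
  exact Ultrafilter.eventually_not

lemma mem_of_imp (hp : IsType p) {φ ψ : FO2 K} (hφ : φ ∈ p)
    (h : ∀ (M : Type) (S : Str K M) (a b : M), Sat2 S φ a b → Sat2 S ψ a b) : ψ ∈ p := by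
  obtain ⟨𝒰, rfl⟩ := hp
  exact Filter.Eventually.mono hφ fun m => h _ _ _ _

lemma mem_iff_of_iff (hp : IsType p) {φ ψ : FO2 K}
    (h : ∀ (M : Type) (S : Str K M) (a b : M), Sat2 S φ a b ↔ Sat2 S ψ a b) : φ ∈ p ↔ ψ ∈ p :=
  ⟨fun hφ => hp.mem_of_imp hφ fun M S a b => (h M S a b).1,
    fun hψ => hp.mem_of_imp hψ fun M S a b => (h M S a b).2⟩

lemma mem_of_valid (hp : IsType p) {φ : FO2 K}
    (h : ∀ (M : Type) (S : Str K M) (a b : M), Sat2 S φ a b) : φ ∈ p := by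
  obtain ⟨𝒰, rfl⟩ := hp
  exact .of_forall fun m => h _ _ _ _

lemma exists_holds (hp : IsType p) {φ : FO2 K} (hφ : φ ∈ p) :
    ∃ m : Pointed K, m.Holds φ := by
  obtain ⟨𝒰, rfl⟩ := hp
  exact Filter.Eventually.exists hφ

lemma eq_of_subset (hp : IsType p) (hq : IsType q) (h : p ⊆ q) : p = q := by
  refine h.antisymm fun φ hφ => ?_
  by_contra hn
  exact hq.not_mem_iff.1 (h (hp.not_mem_iff.2 hn)) hφ

lemma leftType_eq_self (hp : IsType p) (hd : FOV.eq 0 1 ∈ p) : leftType p = p := by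
  refine (eq_of_subset hp hp.left fun φ hφ => ?_).symm
  refine hp.mem_of_imp (hp.and_mem_iff.2 ⟨hd, hφ⟩) fun M S a b h => ?_
  obtain ⟨h1, h2⟩ := h
  obtain rfl : a = b := h1
  exact (sat2_diagL S φ a a).2 h2

lemma rightType_eq_self (hp : IsType p) (hd : FOV.eq 0 1 ∈ p) : rightType p = p := by
  refine (eq_of_subset hp hp.right fun φ hφ => ?_).symm
  refine hp.mem_of_imp (hp.and_mem_iff.2 ⟨hd, hφ⟩) fun M S a b h => ?_
  obtain ⟨h1, h2⟩ := h
  obtain rfl : a = b := h1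
  exact (sat2_diagR S φ a a).2 h2

lemma convType_eq_self (hp : IsType p) (hd : FOV.eq 0 1 ∈ p) : convType p = p := by
  refine (eq_of_subset hp hp.conv fun φ hφ => ?_).symm
  refine hp.mem_of_imp (hp.and_mem_iff.2 ⟨hd, hφ⟩) fun M S a b h => ?_
  obtain ⟨h1, h2⟩ := h
  obtain rfl : a = b := h1
  exact (sat2_flip S φ a a).2 h2

lemma convType_convType (hp : IsType p) : convType (convType p) = p := by
  ext φ
  exact hp.mem_iff_of_iff fun M S a b => by rw [sat2_flip, sat2_flip]

lemma leftType_convType (hp : IsType p) : leftType (convType p) = rightType p := by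
  ext φ
  exact hp.mem_iff_of_iff fun M S a b => by rw [sat2_flip, sat2_diagL, sat2_diagR]

lemma eq_mem_leftType (hp : IsType p) : FOV.eq 0 1 ∈ leftType p :=
  hp.mem_of_valid fun _ S a b => (sat2_diagL S _ a b).2 rfl

lemma ex_one_mem_leftType_iff (hp : IsType p) {φ : FO2 K} :
    FOV.ex 1 φ ∈ leftType p ↔ FOV.ex 1 φ ∈ p :=
  hp.mem_iff_of_iff fun M S a b => by rw [sat2_diagL, sat2_ex_one, sat2_ex_one]

lemma exAll_mem_leftType_iff (hp : IsType p) {φ : FO2 K} :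
    exAll φ ∈ leftType p ↔ exAll φ ∈ p :=
  hp.mem_iff_of_iff fun M S a b => by rw [sat2_diagL, sat2_exAll, sat2_exAll]

lemma exAll_mem_rightType_iff (hp : IsType p) {φ : FO2 K} :
    exAll φ ∈ rightType p ↔ exAll φ ∈ p :=
  hp.mem_iff_of_iff fun M S a b => by rw [sat2_diagR, sat2_exAll, sat2_exAll]

lemma exAll_mem_convType_iff (hp : IsType p) {φ : FO2 K} :
    exAll φ ∈ convType p ↔ exAll φ ∈ p :=
  hp.mem_iff_of_iff fun M S a b => by rw [sat2_flip, sat2_exAll, sat2_exAll]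

lemma ex_one_mem (hp : IsType p) {φ : FO2 K} (h : φ ∈ p) : FOV.ex 1 φ ∈ p :=
  hp.mem_of_imp h fun _ S a b h => (sat2_ex_one S φ a b).2 ⟨b, h⟩

lemma ex_one_mem_iff_of_leftType_eq (hp : IsType p) (hq : IsType q)
    (h : leftType p = leftType q) {φ : FO2 K} : FOV.ex 1 φ ∈ p ↔ FOV.ex 1 φ ∈ q := by
  rw [← hp.ex_one_mem_leftType_iff, h, hq.ex_one_mem_leftType_iff]

end IsType

/-- A set of formulas that contains a formula and is closed under conjunction. -/
structure ConjClosed (p : Set (FO2 K)) : Prop where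
  nonempty : p.Nonempty
  and_mem : ∀ φ ∈ p, ∀ ψ ∈ p, FOV.and φ ψ ∈ p

lemma IsType.conjClosed {p : Set (FO2 K)} (hp : IsType p) : ConjClosed p :=
  ⟨⟨.eq 0 0, hp.mem_of_valid fun _ _ _ _ => rfl⟩, fun _ h _ h' => hp.and_mem_iff.2 ⟨h, h'⟩⟩

/-- Compactness, for two sets of formulas evaluated at two images of a pointed structure that
belongs to a given class. -/
lemma exists_ultrafilter {α : Type 1} {p : Set (FO2 K)} {q : Set (FO2 K')} (hp : ConjClosed p)
    (hq : ConjClosed q) (f : α → Pointed K) (g : α → Pointed K') (D : Set α)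
    (h : ∀ φ ∈ p, ∀ ψ ∈ q, ∃ m ∈ D, (f m).Holds φ ∧ (g m).Holds ψ) :
    ∃ 𝒰 : Ultrafilter α, D ∈ 𝒰 ∧ p ⊆ typeOf (𝒰.map f) ∧ q ⊆ typeOf (𝒰.map g) := by
  obtain ⟨φ₀, hφ₀⟩ := hp.nonempty
  obtain ⟨ψ₀, hψ₀⟩ := hq.nonempty
  let A : p × q → Set α := fun i => {m | m ∈ D ∧ (f m).Holds i.1 ∧ (g m).Holds i.2}
  have : Nonempty (p × q) := ⟨⟨φ₀, hφ₀⟩, ⟨ψ₀, hψ₀⟩⟩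
  have dir : Directed (· ≥ ·) fun i => Filter.principal (A i) := by
    intro i j
    refine ⟨⟨⟨.and i.1 j.1, hp.and_mem _ i.1.2 _ j.1.2⟩, ⟨.and i.2 j.2, hq.and_mem _ i.2.2 _ j.2.2⟩⟩,
      ?_, ?_⟩
    · exact Filter.principal_mono.2 fun m hm => ⟨hm.1, hm.2.1.1, hm.2.2.1⟩
    · exact Filter.principal_mono.2 fun m hm => ⟨hm.1, hm.2.1.2, hm.2.2.2⟩
  have : (⨅ i, Filter.principal (A i)).NeBot := by
    refine Filter.iInf_neBot_of_directed' dir fun i => Filter.principal_neBot_iff.2 ?_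
    obtain ⟨m, hm⟩ := h _ i.1.2 _ i.2.2
    exact ⟨m, hm⟩
  have mem : ∀ i, A i ∈ Ultrafilter.of (⨅ i, Filter.principal (A i)) := fun i =>
    Ultrafilter.of_le _ (Filter.mem_iInf_of_mem i (Filter.mem_principal_self _))
  refine ⟨Ultrafilter.of (⨅ i, Filter.principal (A i)), ?_, ?_, ?_⟩
  · exact Filter.mem_of_superset (mem ⟨⟨φ₀, hφ₀⟩, ⟨ψ₀, hψ₀⟩⟩) fun m hm => hm.1
  · exact fun φ hφ => Filter.mem_of_superset (mem ⟨⟨φ, hφ⟩, ⟨ψ₀, hψ₀⟩⟩) fun m hm => hm.2.1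
  · exact fun ψ hψ => Filter.mem_of_superset (mem ⟨⟨φ₀, hφ₀⟩, ⟨ψ, hψ⟩⟩) fun m hm => hm.2.2

namespace IsType

variable {p q : Set (FO2 K)}

lemma eq_typeOf (hp : IsType p) {𝒰 : Ultrafilter (Pointed K)} (h : p ⊆ typeOf 𝒰) :
    typeOf 𝒰 = p := (hp.eq_of_subset ⟨𝒰, rfl⟩ h).symm

lemma exists_extension (hp : IsType p) {φ : FO2 K} (h : FOV.ex 1 φ ∈ p) :
    ∃ c, IsType c ∧ φ ∈ c ∧ leftType c = leftType p := by
  obtain ⟨𝒰, h1, h2, -⟩ := exists_ultrafilter hp.left.conjClosed hp.left.conjClosed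
    Pointed.left Pointed.left {m | m.Holds φ} (by
      intro χ hχ ψ hψ
      obtain ⟨m, ⟨h1, h2⟩, h3⟩ := hp.exists_holds
        (hp.and_mem_iff.2 ⟨hp.and_mem_iff.2 ⟨hχ, hψ⟩, h⟩)
      obtain ⟨b, hb⟩ := (sat2_ex_one m.str φ _ _).1 h3
      exact ⟨⟨m.carrier, m.str, m.fst, b⟩, hb, (sat2_diagL _ _ _ _).1 h1,
        (sat2_diagL _ _ _ _).1 h2⟩)
  exact ⟨typeOf 𝒰, ⟨𝒰, rfl⟩, h1, by rw [← typeOf_map_left, hp.left.eq_typeOf h2]⟩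

lemma exists_amalgam (hp : IsType p) (hq : IsType q)
    (hpq : ∀ φ, exAll φ ∈ p ↔ exAll φ ∈ q) :
    ∃ c, IsType c ∧ leftType c = leftType p ∧ rightType c = leftType q := by
  obtain ⟨𝒰, -, h1, h2⟩ := exists_ultrafilter hp.left.conjClosed hq.left.conjClosed
    Pointed.left Pointed.right Set.univ (by
      intro φ hφ ψ hψ
      have : exAll (diagL φ) ∈ p := hp.mem_of_imp hφ fun _ _ a b h =>
        (sat2_exAll _ _ _ _).2 ⟨a, b, h⟩
      obtain ⟨m, h1, h2⟩ := hq.exists_holds (hq.and_mem_iff.2 ⟨(hpq _).1 this, hψ⟩)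
      obtain ⟨a, b, hab⟩ := (sat2_exAll _ _ _ _).1 h1
      exact ⟨⟨m.carrier, m.str, a, m.fst⟩, trivial, (sat2_diagL _ _ _ _).1 hab,
        (sat2_diagL _ _ _ _).1 h2⟩)
  refine ⟨typeOf 𝒰, ⟨𝒰, rfl⟩, ?_, ?_⟩
  · rw [← typeOf_map_left, hp.left.eq_typeOf h1]
  · rw [← typeOf_map_right, hq.left.eq_typeOf h2]

lemma exists_split (hp : IsType p) (hq : IsType q) (hl : leftType p = leftType q)
    (hr : rightType p = rightType q) (hne : p ≠ q) :
    ∃ e, IsType e ∧ FOV.eq 0 1 ∉ e ∧ leftType e = rightType p ∧ rightType e = rightType p := by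
  obtain ⟨θ, hθ, hθ'⟩ : ∃ θ ∈ p, θ ∉ q := by
    by_contra! h
    exact hne (hp.eq_of_subset hq h)
  obtain ⟨𝒰, h0, h1, h2⟩ := exists_ultrafilter hp.right.conjClosed hp.right.conjClosed
    Pointed.left Pointed.right {m | ¬ m.Holds (.eq 0 1)} (by
      intro φ hφ ψ hψ
      have h1 : FOV.ex 1 (.and (diagR φ) θ) ∈ p := hp.ex_one_mem (hp.and_mem_iff.2 ⟨hφ, hθ⟩)
      have h2 : FOV.ex 1 (.and (diagR ψ) (.not θ)) ∈ p := by
        rw [hp.ex_one_mem_iff_of_leftType_eq hq hl]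
        refine hq.ex_one_mem (hq.and_mem_iff.2 ⟨?_, hq.not_mem_iff.2 hθ'⟩)
        rw [hr] at hψ
        exact hψ
      obtain ⟨m, h3, h4⟩ := hp.exists_holds (hp.and_mem_iff.2 ⟨h1, h2⟩)
      obtain ⟨b, hb, hbθ⟩ := (sat2_ex_one _ _ _ _).1 h3
      obtain ⟨b', hb', hbθ'⟩ := (sat2_ex_one _ _ _ _).1 h4
      refine ⟨⟨m.carrier, m.str, b, b'⟩, ?_, (sat2_diagR _ _ _ _).1 hb, (sat2_diagR _ _ _ _).1 hb'⟩
      intro h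
      obtain rfl : b = b' := h
      exact hbθ' hbθ)
  refine ⟨typeOf 𝒰, ⟨𝒰, rfl⟩, Ultrafilter.eventually_not.1 h0, ?_, ?_⟩
  · rw [← typeOf_map_left, hp.right.eq_typeOf h1]
  · rw [← typeOf_map_right, hp.right.eq_typeOf h2]

end IsType

end Types

/-! ### Transitive saturated structures -/

section Canonical

variable {K M : Type}

/-- Every 2-type over the type of an element is realised at that element. -/
def Saturated (S : Str K M) : Prop :=
  ∀ a c, IsType c → leftType c = Type2 S a a → ∃ b, Type2 S a b = c

lemma exAll_mem_type2_iff (S : Str K M) (φ : FO2 K) (a b a' b' : M) :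
    exAll φ ∈ Type2 S a b ↔ exAll φ ∈ Type2 S a' b' :=
  (sat2_exAll S φ a b).trans (sat2_exAll S φ a' b').symm

/-- The 2-types having the same sentences as a given type form a type system. -/
lemma isTypeSystem (W : Set (FO2 K)) :
    IsTypeSystem (T := {p : Set (FO2 K) // IsType p ∧ ∀ φ, exAll φ ∈ p ↔ exAll φ ∈ W})
      (fun p => FOV.eq 0 1 ∈ p.1)
      (fun p => ⟨leftType p.1, p.2.1.left, fun φ =>
        p.2.1.exAll_mem_leftType_iff.trans (p.2.2 φ)⟩)
      (fun p => ⟨rightType p.1, p.2.1.right, fun φ =>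
        p.2.1.exAll_mem_rightType_iff.trans (p.2.2 φ)⟩)
      (fun p => ⟨convType p.1, p.2.1.conv, fun φ =>
        p.2.1.exAll_mem_convType_iff.trans (p.2.2 φ)⟩) where
  d_l c := c.2.1.eq_mem_leftType
  l_of_d c hc := Subtype.ext (c.2.1.leftType_eq_self hc)
  r_of_d c hc := Subtype.ext (c.2.1.rightType_eq_self hc)
  cv_of_d c hc := Subtype.ext (c.2.1.convType_eq_self hc)
  cv_cv c := Subtype.ext c.2.1.convType_convType
  l_cv c := Subtype.ext c.2.1.leftType_convType
  amalg p q hp hq := by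
    obtain ⟨c, hc, h1, h2⟩ := p.2.1.exists_amalgam q.2.1 fun φ => (p.2.2 φ).trans (q.2.2 φ).symm
    rw [p.2.1.leftType_eq_self hp] at h1
    rw [q.2.1.leftType_eq_self hq] at h2
    refine ⟨⟨c, hc, fun φ => ?_⟩, Subtype.ext h1, Subtype.ext h2⟩
    rw [← hc.exAll_mem_leftType_iff, h1, p.2.2]
  split p q hl hr hne := by
    obtain ⟨e, he, hd, h1, h2⟩ := p.2.1.exists_split q.2.1 (congrArg Subtype.val hl)
      (congrArg Subtype.val hr) fun h => hne (Subtype.ext h)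
    refine ⟨⟨e, he, fun φ => ?_⟩, hd, Subtype.ext h1, Subtype.ext h2⟩
    rw [← he.exAll_mem_leftType_iff, h1, p.2.1.exAll_mem_rightType_iff, p.2.2]

/-- Every complete 2-type is realised in a transitive saturated structure. -/
theorem IsType.exists_transitive_saturated {W : Set (FO2 K)} (hW : IsType W) :
    ∃ (U : Type) (S : Str K U),
      IsTransitive S ∧ Saturated S ∧ ∃ a b, Type2 S a b = W := by
  obtain ⟨U, col, hd, hl, hcv, hsurj, hext, haut⟩ := (isTypeSystem W).exists_coloring
  let S : Str K U := fun s a b => FOV.rel s 0 1 ∈ (col a b).1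
  have hl' : ∀ a b, leftType (col a b).1 = (col a a).1 := fun a b => congrArg Subtype.val (hl a b)
  have hcv' : ∀ a b, (col b a).1 = convType (col a b).1 := fun a b =>
    congrArg Subtype.val (hcv a b)
  have ht : ∀ a b, IsType (col a b).1 := fun a b => (col a b).2.1
  have hext' : ∀ a c, IsType c → leftType c = (col a a).1 → ∃ b, (col a b).1 = c := by
    intro a c hc h
    obtain ⟨b, hb⟩ := hext a ⟨c, hc, fun φ => by
      rw [← hc.exAll_mem_leftType_iff, h, (col a a).2.2]⟩ (Subtype.ext h)
    exact ⟨b, congrArg Subtype.val hb⟩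
  have mem_flip : ∀ φ a b, flip φ ∈ (col a b).1 ↔ φ ∈ (col b a).1 := by
    intro φ a b
    rw [hcv' a b]
    rfl
  have mem_diag : ∀ φ a b, diagL φ ∈ (col a b).1 ↔ φ ∈ (col a a).1 := by
    intro φ a b
    rw [← hl' a b]
    rfl
  have ex_one : ∀ φ a b, FOV.ex 1 φ ∈ (col a b).1 ↔ ∃ c, φ ∈ (col a c).1 := by
    intro φ a b
    constructor
    · intro h
      obtain ⟨c, hc, hφ, hcl⟩ := (ht a b).exists_extension h
      obtain ⟨e, rfl⟩ := hext' a c hc (hcl.trans (hl' a b))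
      exact ⟨e, hφ⟩
    · rintro ⟨c, hc⟩
      rw [(ht a b).ex_one_mem_iff_of_leftType_eq (ht a c) ((hl' a b).trans (hl' a c).symm)]
      exact (ht a c).ex_one_mem hc
  have truth : ∀ φ a b, Sat2 S φ a b ↔ φ ∈ (col a b).1 := by
    intro φ
    induction φ with
    | eq i j =>
      intro a b
      fin_cases i <;> fin_cases j
      · exact iff_of_true rfl ((ht a b).mem_of_valid fun _ _ _ _ => rfl)
      · exact (hd a b).symm
      · refine Iff.trans ?_ ((mem_flip (.eq 0 1) a b).trans (hd b a)).symm |>.trans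
          ((ht a b).mem_iff_of_iff fun M S a b => ?_)
        · exact Iff.rfl
        · rw [sat2_flip]
          exact Iff.rfl
      · exact iff_of_true rfl ((ht a b).mem_of_valid fun _ _ _ _ => rfl)
    | rel s i j =>
      intro a b
      fin_cases i <;> fin_cases j
      · refine (mem_diag (.rel s 0 1) a b).symm.trans
          ((ht a b).mem_iff_of_iff fun M S a b => ?_)
        rw [sat2_diagL]
        exact Iff.rfl
      · exact Iff.rfl
      · refine (mem_flip (.rel s 0 1) a b).symm.trans
          ((ht a b).mem_iff_of_iff fun M S a b => ?_)
        rw [sat2_flip]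
        exact Iff.rfl
      · refine ((mem_flip (diagL (.rel s 0 1)) a b).trans
          (mem_diag (.rel s 0 1) b a)).symm.trans
          ((ht a b).mem_iff_of_iff fun M S a b => ?_)
        rw [sat2_flip, sat2_diagL]
        exact Iff.rfl
    | not φ ih =>
      intro a b
      rw [sat2_not, ih, (ht a b).not_mem_iff]
    | and φ ψ ih ih' =>
      intro a b
      rw [sat2_and, ih, ih', (ht a b).and_mem_iff]
    | ex i φ ih =>
      intro a b
      fin_cases i
      · have h : FOV.ex 0 φ ∈ (col a b).1 ↔ flip (.ex 1 (flip φ)) ∈ (col a b).1 :=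
          (ht a b).mem_iff_of_iff fun M S a b => by
            simp only [sat2_flip, sat2_ex_zero, sat2_ex_one]
        refine (sat2_ex_zero S φ a b).trans ?_
        refine Iff.trans ?_ h.symm
        rw [mem_flip, ex_one]
        exact exists_congr fun c => (ih c b).trans (mem_flip φ b c).symm
      · refine (sat2_ex_one S φ a b).trans (Iff.trans ?_ (ex_one φ a b).symm)
        exact exists_congr fun c => ih a c
  have type_eq : ∀ a b, Type2 S a b = (col a b).1 := fun a b => Set.ext fun φ => truth φ a b
  refine ⟨U, S, ?_, ?_, ?_⟩
  · intro a b hab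
    rw [type_eq, type_eq] at hab
    obtain ⟨f, hf, hfcol⟩ := haut a b (Subtype.ext hab)
    refine ⟨f, fun s x y => ?_, hf⟩
    simp only [S, hfcol]
  · intro a c hc h
    rw [type_eq] at h
    obtain ⟨b, hb⟩ := hext' a c hc h
    exact ⟨b, (type_eq a b).trans hb⟩
  · obtain ⟨a, ha⟩ := hsurj ⟨leftType W, hW.left, fun φ => hW.exAll_mem_leftType_iff⟩
      hW.eq_mem_leftType
    obtain ⟨b, hb⟩ := hext' a W hW (congrArg Subtype.val ha).symm
    exact ⟨a, b, (type_eq a b).trans hb⟩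

lemma Saturated.exists_type2_eq {S : Str K M} (hS : Saturated S) {a₀ b₀ : M}
    {p : Set (FO2 K)} (hp : IsType p) (h : ∀ φ, exAll φ ∈ Type2 S a₀ b₀ ↔ exAll φ ∈ p) :
    ∃ a b, Type2 S a b = p := by
  obtain ⟨c, hc, h1, h2⟩ := (isType_type2 S a₀ b₀).exists_amalgam hp h
  rw [leftType_type2] at h1
  obtain ⟨a, rfl⟩ := hS a₀ c hc h1
  rw [rightType_type2] at h2
  exact ⟨a, hS a p hp h2.symm⟩

lemma Saturated.reduct {L : Type} {S : Str (L ⊕ Unit) M} (hS : Saturated S) :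
    Saturated (fun s => S (.inl s)) := by
  intro a c hc h
  obtain ⟨𝒰, -, h1, h2⟩ := exists_ultrafilter (isType_type2 S a a).conjClosed hc.conjClosed
    Pointed.left Pointed.reduct Set.univ (by
      intro φ hφ ψ hψ
      have : FOV.ex 1 ψ ∈ Type2 (fun s => S (.inl s)) a a := by
        rw [← h, hc.ex_one_mem_leftType_iff]
        exact hc.ex_one_mem hψ
      obtain ⟨b, hb⟩ := (sat2_ex_one _ _ _ _).1 this
      exact ⟨⟨M, S, a, b⟩, trivial, hφ, hb⟩)
  obtain ⟨b, hb⟩ := hS a (typeOf 𝒰) ⟨𝒰, rfl⟩ (by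
    rw [← typeOf_map_left, (isType_type2 S a a).eq_typeOf h1])
  refine ⟨b, ?_⟩
  rw [← reductType_type2, hb, ← typeOf_map_reduct, hc.eq_typeOf h2]

end Canonical

/-! ### Uniquely determined relations do not cut types -/

section NoCut

variable {K L M N : Type}

lemma sat2_equiv {S : Str K M} {S' : Str K N} (f : M ≃ N)
    (hf : ∀ s a b, S s a b ↔ S' s (f a) (f b)) (φ : FO2 K) (a b : M) :
    Sat2 S φ a b ↔ Sat2 S' φ (f a) (f b) := by
  refine sat2_congr_of_backForth (Z := fun a b a' b' => a' = f a ∧ b' = f b)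
    ?_ ?_ ?_ ?_ ?_ ?_ φ ⟨rfl, rfl⟩
  · rintro a b _ _ ⟨rfl, rfl⟩
    exact f.injective.eq_iff.symm
  · rintro a b _ _ ⟨rfl, rfl⟩ s
    exact hf s a b
  · rintro a b _ _ ⟨h, -⟩
    exact ⟨h, h⟩
  · rintro a b _ _ ⟨h, h'⟩
    exact ⟨h', h⟩
  · rintro a b _ _ ⟨h, -⟩ c
    exact ⟨f c, h, rfl⟩
  · rintro a b _ _ ⟨h, -⟩ c
    exact ⟨f.symm c, h, (f.apply_symm_apply c).symm⟩

lemma IsAuto.type2_eq {S : Str K M} {f : M ≃ M} (hf : IsAuto S f) (a b : M) :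
    Type2 S (f a) (f b) = Type2 S a b :=
  Set.ext fun φ => (sat2_equiv f hf φ a b).symm

/-- A relation determined uniquely by `Sg` is invariant under automorphisms. -/
lemma IsAuto.rel_iff {S : Str L M} {R : M → M → Prop} {Sg : Set (FO2 (L ⊕ Unit))}
    (hR : ModelsSet (expand S R) Sg) (huniq : ∀ R', ModelsSet (expand S R') Sg → R' = R)
    {f : M ≃ M} (hf : IsAuto S f) (a b : M) : R (f a) (f b) ↔ R a b := by
  have h : (fun a b => R (f a) (f b)) = R := by
    refine huniq _ ((modelsSet_iff_sat2 _ _).2 fun φ hφ a b => ?_)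
    refine (sat2_equiv (S' := expand S R) f ?_ φ a b).2
      ((modelsSet_iff_sat2 _ _).1 hR φ hφ _ _)
    rintro (s | s) a b
    · exact hf s a b
    · exact Iff.rfl
  exact iff_of_eq (congrFun (congrFun h a) b)

/-- The truth values of a relation at a pair and at its converse. -/
def color (R : M → M → Prop) (a b : M) : Prop × Prop := (R a b, R b a)

lemma swap_color (R : M → M → Prop) (a b : M) : (color R a b).swap = color R b a := rfl

/-- Two colors attained on a type can be chosen so that their transposition commutes with
taking converses, if the type is symmetric. -/
lemma exists_color_pair {T : Set (Prop × Prop)} {sym : Prop}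
    (hsym : sym → ∀ k ∈ T, k.swap ∈ T) {k k' : Prop × Prop} (hk : k ∈ T) (hk' : k' ∈ T)
    (hne : k.1 ≠ k'.1) :
    ∃ k₁ ∈ T, ∃ k₂ ∈ T, k₁.1 ≠ k₂.1 ∧
      (sym → k₁ = k₂.swap ∨ (k₁.swap = k₁ ∧ k₂.swap = k₂)) := by
  have aux : ∀ c : Prop × Prop, c.swap ≠ c → c.1 ≠ c.swap.1 := by
    rintro ⟨p, q⟩ h h'
    obtain rfl : p = q := h'
    exact h rfl
  by_cases hs : sym
  · by_cases h : k.swap = k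
    · by_cases h' : k'.swap = k'
      · exact ⟨k, hk, k', hk', hne, fun _ => .inr ⟨h, h'⟩⟩
      · exact ⟨k', hk', k'.swap, hsym hs _ hk', aux _ h', fun _ => .inl k'.swap_swap.symm⟩
    · exact ⟨k, hk, k.swap, hsym hs _ hk, aux _ h, fun _ => .inl k.swap_swap.symm⟩
  · exact ⟨k, hk, k', hk', hne, fun h => (hs h).elim⟩

open Classical in
/-- The relation obtained from `R` by permuting its colors on the pairs of type `t`. -/
def recolor (S : Str L M) (R : M → M → Prop) (t : Set (FO2 L)) (π : Prop × Prop → Prop × Prop)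
    (u v : M) : Prop :=
  if Type2 S u v = t then (π (color R u v)).1
  else if Type2 S v u = t then (π (color R v u)).2 else R u v

section Recolor

variable {S : Str L M} {R : M → M → Prop} {t : Set (FO2 L)} {π : Prop × Prop → Prop × Prop}

lemma color_recolor (hπ : convType t = t → ∀ k, π k.swap = (π k).swap) {u v : M}
    (h : Type2 S u v = t) : color (recolor S R t π) u v = π (color R u v) := by
  refine Prod.ext (by simp [color, recolor, h]) ?_
  by_cases h' : Type2 S v u = t
  · have : convType t = t := by rw [← h, convType_type2, h', h]
    have := congrArg Prod.fst (hπ this (color R u v))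
    simpa [color, recolor, h, h'] using this
  · simp [color, recolor, h, h']

lemma color_recolor_of_ne {u v : M} (h : Type2 S u v ≠ t) (h' : Type2 S v u ≠ t) :
    color (recolor S R t π) u v = color R u v := by
  simp [color, recolor, h, h']

lemma exists_color_recolor_eq (hπ : convType t = t → ∀ k, π k.swap = (π k).swap)
    (hinv : ∀ k, π (π k) = k)
    (hT : ∀ u v, Type2 S u v = t → ∃ u' v', Type2 S u' v' = t ∧ color R u' v' = π (color R u v))
    (hom : ∀ a a', Type2 S a a = Type2 S a' a' → ∀ c, ∃ c', Type2 S a c = Type2 S a' c' ∧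
      color R a c = color R a' c') (u c : M) :
    ∃ c', Type2 S u c' = Type2 S u c ∧ color (recolor S R t π) u c' = color R u c ∧
      color R u c' = color (recolor S R t π) u c := by
  by_cases h : Type2 S u c = t
  · obtain ⟨u₁, v₁, h1, h2⟩ := hT u c h
    obtain ⟨c', h3, h4⟩ := hom u₁ u (by
      rw [← leftType_type2 S u₁ v₁, ← leftType_type2 S u c, h, h1]) v₁
    have h5 : Type2 S u c' = t := h3.symm.trans h1
    refine ⟨c', h5.trans h.symm, ?_, ?_⟩
    · rw [color_recolor hπ h5, ← h4, h2, hinv]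
    · rw [color_recolor hπ h, ← h4, h2]
  · by_cases h' : Type2 S c u = t
    · obtain ⟨u₁, v₁, h1, h2⟩ := hT c u h'
      obtain ⟨c', h3, h4⟩ := hom v₁ u (by
        rw [← rightType_type2 S u₁ v₁, ← rightType_type2 S c u, h', h1]) u₁
      have h5 : Type2 S c' u = t := by
        rw [← convType_type2 S u c', ← h3, convType_type2, h1]
      have h6 : color R c' u = π (color R c u) := by
        rw [← h2, ← swap_color R u c', ← h4, swap_color]
      refine ⟨c', ?_, ?_, ?_⟩
      · rw [← convType_type2 S c' u, ← convType_type2 S c u, h5, h']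
      · rw [← swap_color _ c' u, color_recolor hπ h5, h6, hinv, swap_color]
      · rw [← swap_color _ c u, color_recolor hπ h', ← h6, swap_color]
    · have := color_recolor_of_ne (R := R) (π := π) h h'
      exact ⟨c, rfl, this, this.symm⟩

lemma modelsSet_recolor {Sg : Set (FO2 (L ⊕ Unit))} (hR : ModelsSet (expand S R) Sg)
    (hd : FOV.eq 0 1 ∉ t)
    (hπ : convType t = t → ∀ k, π k.swap = (π k).swap)
    (hinv : ∀ k, π (π k) = k)
    (hT : ∀ u v, Type2 S u v = t → ∃ u' v', Type2 S u' v' = t ∧ color R u' v' = π (color R u v))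
    (hom : ∀ a a', Type2 S a a = Type2 S a' a' → ∀ c, ∃ c', Type2 S a c = Type2 S a' c' ∧
      color R a c = color R a' c') : ModelsSet (expand S (recolor S R t π)) Sg := by
  have eq_iff : ∀ a b a' b', Type2 S a b = Type2 S a' b' → (a = b ↔ a' = b') := fun a b a' b' h =>
    iff_of_eq (congrArg (FOV.eq 0 1 ∈ ·) h)
  have hne : ∀ a, Type2 S a a ≠ t := by
    rintro a rfl
    exact hd rfl
  have diag_color : ∀ a a', Type2 S a a = Type2 S a' a' → color R a a = color R a' a' := by
    intro a a' h
    obtain ⟨c', h1, h2⟩ := hom a a' h a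
    obtain rfl : a' = c' := (eq_iff _ _ _ _ h1).1 rfl
    exact h2
  have key := exists_color_recolor_eq hπ hinv hT hom
  refine (modelsSet_iff_sat2 _ _).2 fun φ hφ a b => ?_
  have hleft : ∀ {u v u' v'}, Type2 S u v = Type2 S u' v' → Type2 S u u = Type2 S u' u' := by
    intro u v u' v' h
    rw [← leftType_type2 S u v, h, leftType_type2]
  have hdiag : ∀ {u u'}, Type2 S u u = Type2 S u' u' →
      color R u u = color (recolor S R t π) u' u' := by
    intro u u' h
    rw [color_recolor_of_ne (hne _) (hne _), diag_color _ _ h]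
  obtain ⟨b', h1, -, h2⟩ := key a b
  refine (sat2_congr_of_backForth (S := expand S R)
    (Z := fun u v u' v' => Type2 S u v = Type2 S u' v' ∧
      color R u v = color (recolor S R t π) u' v') ?_ ?_ ?_ ?_ ?_ ?_ φ (a := a) (b := b')
      ⟨h1, h2⟩).1 ((modelsSet_iff_sat2 _ _).1 hR φ hφ _ _)
  · exact fun u v u' v' h => eq_iff _ _ _ _ h.1
  · rintro u v u' v' ⟨h, h'⟩ (s | s)
    · exact iff_of_eq (congrArg (FOV.rel s 0 1 ∈ ·) h)
    · exact iff_of_eq (congrArg Prod.fst h')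
  · exact fun u v u' v' h => ⟨hleft h.1, hdiag (hleft h.1)⟩
  · rintro u v u' v' ⟨h, h'⟩
    exact ⟨by rw [← convType_type2, h, convType_type2], by
      rw [← swap_color, h', swap_color]⟩
  · rintro u v u' v' ⟨h, -⟩ c
    obtain ⟨c₁, h1, h2⟩ := hom u u' (hleft h) c
    obtain ⟨c', h3, h4, -⟩ := key u' c₁
    exact ⟨c', h1.trans h3.symm, h2.trans h4.symm⟩
  · rintro u v u' v' ⟨h, -⟩ c
    obtain ⟨c₁, h1, -, h2⟩ := key u' c
    obtain ⟨c', h3, h4⟩ := hom u' u (hleft h).symm c₁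
    exact ⟨c', h3.symm.trans h1, h4.symm.trans h2⟩

end Recolor

open Classical in
/-- In a transitive structure, a relation determined uniquely by `Sg` does not cut 2-types. -/
theorem IsTransitive.noCut {S : Str L M} (hS : IsTransitive S) {R : M → M → Prop}
    {Sg : Set (FO2 (L ⊕ Unit))} (hR : ModelsSet (expand S R) Sg)
    (huniq : ∀ R', ModelsSet (expand S R') Sg → R' = R) : NoCut S R := by
  have hom : ∀ a a', Type2 S a a = Type2 S a' a' → ∀ c, ∃ c', Type2 S a c = Type2 S a' c' ∧
      color R a c = color R a' c' := by
    intro a a' h c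
    obtain ⟨f, hf, rfl⟩ := hS a a' h
    exact ⟨f c, (hf.type2_eq a c).symm, Prod.ext
      (propext (hf.rel_iff hR huniq a c).symm) (propext (hf.rel_iff hR huniq c a).symm)⟩
  intro a b c e h
  by_cases hab : a = b
  · subst hab
    obtain rfl : c = e := (iff_of_eq (congrArg (FOV.eq 0 1 ∈ ·) h)).1 rfl
    obtain ⟨f, hf, rfl⟩ := hS a c h
    exact (hf.rel_iff hR huniq a a).symm
  by_contra hcut
  let T : Set (Prop × Prop) := {k | ∃ u v, Type2 S u v = Type2 S a b ∧ color R u v = k}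
  obtain ⟨k₁, ⟨u, v, huv, hk₁⟩, k₂, hk₂, hne, hsym⟩ :=
    exists_color_pair (T := T) (sym := convType (Type2 S a b) = Type2 S a b)
      (by
        rintro hs _ ⟨u, v, h1, rfl⟩
        exact ⟨v, u, by rw [← convType_type2, h1, hs], rfl⟩)
      ⟨a, b, rfl, rfl⟩ ⟨c, e, h.symm, rfl⟩ fun h' => hcut (iff_of_eq h')
  have hrec := huniq _ (modelsSet_recolor (t := Type2 S a b) (π := Equiv.swap k₁ k₂) hR hab ?_
    (Equiv.swap_apply_self k₁ k₂) ?_ hom)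
  · have h1 : recolor S R (Type2 S a b) (Equiv.swap k₁ k₂) u v = k₂.1 := by
      simp [recolor, huv, hk₁]
    rw [hrec] at h1
    exact hne ((congrArg Prod.fst hk₁).symm.trans h1)
  · intro hs k
    rw [← Prod.swap_injective.swap_apply]
    rcases hsym hs with rfl | ⟨h1, h2⟩
    · rw [Prod.swap_swap, Equiv.swap_comm]
    · rw [h1, h2]
  · intro u' v' h'
    have hmem : color R u' v' ∈ T := ⟨u', v', h', rfl⟩
    rcases eq_or_ne (color R u' v') k₁ with h1 | h1
    · rw [h1, Equiv.swap_apply_left]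
      exact hk₂
    · rcases eq_or_ne (color R u' v') k₂ with h2 | h2
      · rw [h2, Equiv.swap_apply_right]
        exact ⟨u, v, huv, hk₁⟩
      · rw [Equiv.swap_apply_of_ne_of_ne h1 h2]
        exact hmem

end NoCut

/-! ### Explicit definability -/

section Explicit

variable {K L M : Type} {Th : Set (FO2 L)} {Sg : Set (FO2 (L ⊕ Unit))}

lemma modelsSet_of_exAll_not_notMem {S : Str K M} {Γ : Set (FO2 K)} {a b : M}
    (h : ∀ φ ∈ Γ, exAll (.not φ) ∉ Type2 S a b) : ModelsSet S Γ := by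
  refine (modelsSet_iff_sat2 _ _).2 fun φ hφ x y => ?_
  by_contra hn
  exact h φ hφ ((sat2_exAll _ _ _ _).2 ⟨x, y, hn⟩)

lemma expand_reduct (S : Str (L ⊕ Unit) M) :
    expand (fun s => S (.inl s)) (S (.inr ())) = S := by
  funext s
  rcases s with s | s <;> rfl

/-- A 2-type of the expanded language containing the theory `Th` and the definition `Sg`. -/
structure IsModelType (Th : Set (FO2 L)) (Sg : Set (FO2 (L ⊕ Unit)))
    (W : Set (FO2 (L ⊕ Unit))) : Prop where
  isType : IsType W
  theory : ∀ φ ∈ Th, exAll (.not (lift φ)) ∉ W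
  definition : ∀ φ ∈ Sg, exAll (.not φ) ∉ W

/-- A relation not cutting the 2-types of a saturated structure transfers to any saturated
structure with the same sentences. -/
lemma modelsSet_transfer {N : Type} {S : Str L M} {S' : Str L N} (hS : Saturated S)
    (hS' : Saturated S') {R : M → M → Prop} (hcut : NoCut S R) (hR : ModelsSet (expand S R) Sg)
    {a₀ b₀ : M} {a₁ b₁ : N} (h₀ : Type2 S a₀ b₀ = Type2 S' a₁ b₁) :
    ModelsSet (expand S' fun x y => ∃ u v, Type2 S u v = Type2 S' x y ∧ R u v) Sg := by
  refine (modelsSet_iff_sat2 _ _).2 fun φ hφ x y => ?_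
  obtain ⟨a, b, hab⟩ := hS.exists_type2_eq (a₀ := a₀) (b₀ := b₀) (isType_type2 S' x y) fun φ => by
    rw [h₀]
    exact exAll_mem_type2_iff _ _ _ _ _ _
  refine (sat2_congr_of_backForth (S := expand S R)
    (Z := fun u v u' v' => Type2 S u v = Type2 S' u' v') ?_ ?_ ?_ ?_ ?_ ?_ φ hab).1
    ((modelsSet_iff_sat2 _ _).1 hR φ hφ _ _)
  · exact fun u v u' v' h => iff_of_eq (congrArg (FOV.eq 0 1 ∈ ·) h)
  · rintro u v u' v' h (s | s)
    · exact iff_of_eq (congrArg (FOV.rel s 0 1 ∈ ·) h)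
    · refine ⟨fun hr => ⟨u, v, h, hr⟩, ?_⟩
      rintro ⟨u₁, v₁, h1, h2⟩
      exact (hcut _ _ _ _ (h1.trans h.symm)).1 h2
  · intro u v u' v' h
    rw [← leftType_type2 S u v, h, leftType_type2]
  · intro u v u' v' h
    rw [← convType_type2 S u v, h, convType_type2]
  · intro u v u' v' h c
    obtain ⟨c', hc'⟩ := hS' u' _ (isType_type2 S u c) (by
      rw [leftType_type2, ← leftType_type2 S u v, h, leftType_type2])
    exact ⟨c', hc'.symm⟩
  · intro u v u' v' h c'
    exact hS u _ (isType_type2 S' u' c') (by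
      rw [leftType_type2, ← leftType_type2 S u v, h, leftType_type2])

/-- In a transitive saturated model the defined relation is read off from the types of the
expanded language. -/
lemma IsModelType.rel_mem_iff (h : StrongImplicitDef L Th Sg) {W : Set (FO2 (L ⊕ Unit))}
    (hW : IsModelType Th Sg W) {S : Str L M} (hS : Saturated S) {R : M → M → Prop}
    (hcut : NoCut S R) (hR : ModelsSet (expand S R) Sg) {a b : M}
    (hab : Type2 S a b = reductType W) : FOV.rel (.inr ()) 0 1 ∈ W ↔ R a b := by
  obtain ⟨N, S', -, hS', x, y, rfl⟩ := hW.isType.exists_transitive_saturated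
  have hTh : ModelsSet (fun s => S' (.inl s)) Th :=
    modelsSet_of_exAll_not_notMem (a := x) (b := y) fun φ hφ hm =>
      hW.theory φ hφ ((sat2_lift S' (exAll (.not φ)) x y).2 hm)
  have hSg : ModelsSet S' Sg := modelsSet_of_exAll_not_notMem hW.definition
  rw [reductType_type2] at hab
  have h1 := modelsSet_transfer hS hS'.reduct hcut hR hab
  have h2 := (h N _ ⟨x⟩ hTh).unique h1 (by rwa [expand_reduct])
  have h3 : (∃ u v, Type2 S u v = Type2 (fun s => S' (.inl s)) x y ∧ R u v) ↔ S' (.inr ()) x y :=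
    iff_of_eq (congrFun (congrFun h2 x) y)
  refine h3.symm.trans ⟨?_, fun hr => ⟨a, b, hab, hr⟩⟩
  rintro ⟨u, v, huv, hr⟩
  exact (hcut _ _ _ _ (huv.trans hab.symm)).1 hr

/-- Types of the expanded language with the same reduct agree on the defined relation. -/
lemma IsModelType.rel_mem_congr (h : StrongImplicitDef L Th Sg) {W W' : Set (FO2 (L ⊕ Unit))}
    (hW : IsModelType Th Sg W) (hW' : IsModelType Th Sg W') (hred : reductType W = reductType W') :
    FOV.rel (.inr ()) 0 1 ∈ W ↔ FOV.rel (.inr ()) 0 1 ∈ W' := by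
  obtain ⟨U, S, hT, hS, a, b, hab⟩ := hW.isType.reduct.exists_transitive_saturated
  have hTh : ModelsSet S Th := modelsSet_of_exAll_not_notMem (a := a) (b := b) fun φ hφ hm => by
    rw [hab] at hm
    exact hW.theory φ hφ hm
  obtain ⟨R, hR, huniq⟩ := h U S ⟨a⟩ hTh
  have hcut := hT.noCut hR huniq
  exact (hW.rel_mem_iff h hS hcut hR hab).trans
    (hW'.rel_mem_iff h hS hcut hR (hab.trans hred)).symm

/-- The pointed models of `Th` and `Sg`. -/
def pointedModels (Th : Set (FO2 L)) (Sg : Set (FO2 (L ⊕ Unit))) : Set (Pointed (L ⊕ Unit)) :=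
  {m | ModelsSet (fun s => m.str (.inl s)) Th ∧ ModelsSet m.str Sg}

lemma isModelType_typeOf {𝒰 : Ultrafilter (Pointed (L ⊕ Unit))} (h : pointedModels Th Sg ∈ 𝒰) :
    IsModelType Th Sg (typeOf 𝒰) where
  isType := ⟨𝒰, rfl⟩
  theory φ hφ hm := by
    obtain ⟨m, h1, h2⟩ := (Filter.Eventually.and h hm).exists
    obtain ⟨x, y, hxy⟩ := (sat2_exAll _ _ _ _).1 h2
    exact hxy ((sat2_lift _ _ _ _).2 ((modelsSet_iff_sat2 _ _).1 h1.1 φ hφ x y))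
  definition φ hφ hm := by
    obtain ⟨m, h1, h2⟩ := (Filter.Eventually.and h hm).exists
    obtain ⟨x, y, hxy⟩ := (sat2_exAll _ _ _ _).1 h2
    exact hxy ((modelsSet_iff_sat2 _ _).1 h1.2 φ hφ x y)

theorem StrongImplicitDef.exists_formula (h : StrongImplicitDef L Th Sg) :
    ∃ φ : FO2 L, ∀ m ∈ pointedModels Th Sg,
      (m.Holds (.rel (.inr ()) 0 1) ↔ m.reduct.Holds φ) := by
  let ρ : FO2 (L ⊕ Unit) := .rel (.inr ()) 0 1
  let Γ : Set (FO2 L) := {φ | ∀ m ∈ pointedModels Th Sg, m.Holds ρ → m.reduct.Holds φ}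
  have hΓ : ConjClosed Γ := ⟨⟨.eq 0 0, fun _ _ _ => rfl⟩,
    fun φ hφ ψ hψ m hm hr => ⟨hφ m hm hr, hψ m hm hr⟩⟩
  by_contra! hno
  obtain ⟨𝒰₂, hD₂, hΓ₂, -⟩ := exists_ultrafilter hΓ hΓ Pointed.reduct Pointed.reduct
    {m | m ∈ pointedModels Th Sg ∧ ¬ m.Holds ρ} (by
      intro φ hφ ψ hψ
      obtain ⟨m, hm, hn⟩ := hno (.and φ ψ)
      rcases hn with ⟨h1, h2⟩ | ⟨h1, h2⟩
      · exact (h2 ⟨hφ m hm h1, hψ m hm h1⟩).elim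
      · exact ⟨m, ⟨hm, h1⟩, h2⟩)
  rw [typeOf_map_reduct] at hΓ₂
  have hV : IsType (reductType (typeOf 𝒰₂)) := IsType.reduct ⟨𝒰₂, rfl⟩
  obtain ⟨𝒰₁, hD₁, hV₁, -⟩ := exists_ultrafilter hV.conjClosed hV.conjClosed
    Pointed.reduct Pointed.reduct {m | m ∈ pointedModels Th Sg ∧ m.Holds ρ} (by
      intro φ hφ ψ hψ
      by_contra! hn
      refine hV.not_mem_iff.1 (hΓ₂ (a := .not (.and φ ψ)) fun m hm hr => ?_)
        (hV.and_mem_iff.2 ⟨hφ, hψ⟩)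
      exact fun hc => hn m ⟨hm, hr⟩ hc.1 hc.2)
  rw [typeOf_map_reduct] at hV₁
  have hW₁ : IsModelType Th Sg (typeOf 𝒰₁) :=
    isModelType_typeOf (Filter.mem_of_superset hD₁ fun _ hm => hm.1)
  have hW₂ : IsModelType Th Sg (typeOf 𝒰₂) :=
    isModelType_typeOf (Filter.mem_of_superset hD₂ fun _ hm => hm.1)
  have h₁ : ρ ∈ typeOf 𝒰₁ := Filter.mem_of_superset hD₁ fun _ hm => hm.2
  have h₂ : ρ ∉ typeOf 𝒰₂ :=
    Ultrafilter.eventually_not.1 (Filter.mem_of_superset hD₂ fun _ hm => hm.2)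
  exact h₂ ((hW₁.rel_mem_congr h hW₂ (hV.eq_of_subset hW₁.isType.reduct hV₁).symm).1 h₁)

end Explicit

/-- FO2 has the weak Beth definability property: every strong
implicit definition can be made explicit. -/
theorem stmt4 (L : Type) (Th : Set (FO2 L)) (Sg : Set (FO2 (L ⊕ Unit)))
    (hTh : ∀ φ ∈ Th, Sentence φ) (hSg : ∀ φ ∈ Sg, Sentence φ)
    (h : StrongImplicitDef L Th Sg) :
    MadeExplicit L Th Sg := by
  obtain ⟨φ, hφ⟩ := h.exists_formula
  exact ⟨φ, fun M S _ hS R hR a b => hφ ⟨M, expand S R, a, b⟩ ⟨hS, hR⟩⟩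

end AN
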